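/- Define T^{(a)}_m(u) := ξ^{(a)}_m(u − a − m + 1)/ξ(u − a − m + 1) for 0 ≤ a ≤ N+1 and m ≥ 0 (so T^{(a)}_0 ≡ 1). Then these functions solve the T-system for U_q(A^(2)_{2n−1}): for every u ∈ ℂ and every integer m ≥ 1, (i) T^{(a)}_m(u−1)·T^{(a)}_m(u+1) = T^{(a)}_{m−1}(u)·T^{(a)}_{m+1}(u) + T^{(a−1)}_m(u)·T^{(a+1)}_m(u) for 1 ≤ a ≤ n−1, and (ii) T^{(n)}_m(u−1)·T^{(n)}_m(u+1) = T^{(n)}_{m−1}(u)·T^{(n)}_{m+1}(u) + T^{(n−1)}_m(u)·T^{(n−1)}_m(u + s); moreover T^{(0)}_m ≡ 1. -/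

import Mathlib

open Complex

noncomputable def oneSubXD (x w : ℂ → ℂ) : ℂ → ℂ := fun u => w u - x u * w (u + 2)

noncomputable def Lop (x : ℕ → ℂ → ℂ) : ℕ → (ℂ → ℂ) → (ℂ → ℂ)
  | 0 => fun w => w
  | k + 1 => fun w => oneSubXD (x (k + 1)) (Lop x k w)

noncomputable def casorati (N : ℕ) (w : ℕ → ℂ → ℂ) (idx : ℕ → ℕ) (u : ℂ) : ℂ :=
  Matrix.det (Matrix.of fun j k : Fin (N + 1) => w (j.1 + 1) (u + 2 * (idx k.1 : ℂ)))

noncomputable def DsubF (f w : ℂ → ℂ) : ℂ → ℂ := fun u => w (u + 2) - f u * w u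

noncomputable def Lfac (f : ℕ → ℂ → ℂ) (Nv : ℕ) : ℕ → (ℂ → ℂ) → (ℂ → ℂ)
  | 0 => fun w => w
  | a + 1 => fun w => DsubF (f (Nv + 1 - a)) (Lfac f Nv a w)

/-- The three-term Plücker relation for two replaced columns. -/
theorem Matrix.det_mul_det_updateCol_updateCol {ι R : Type*} [Fintype ι] [DecidableEq ι]
    [CommRing R] (X : Matrix ι ι R) {p q : ι} (hpq : p ≠ q) (z t : ι → R) :
    X.det * ((X.updateCol p z).updateCol q t).det
      = (X.updateCol p z).det * (X.updateCol q t).det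
        - (X.updateCol q z).det * (X.updateCol p t).det := by
  set X' := X.updateCol p z with hX'
  have hlin : X.det * (X'.updateCol q t).det
      = ∑ k, (X.updateCol k t).det * (X'.updateCol q (X.col k)).det := by
    have h1 : X.det • t = ∑ k, X.cramer t k • X.col k := by
      rw [← Matrix.mulVec_cramer, Matrix.mulVec_eq_sum]
      simp only [op_smul_eq_smul]
      rfl
    calc X.det * (X'.updateCol q t).det = X'.cramer (X.det • t) q := by
          rw [map_smul, Pi.smul_apply, Matrix.cramer_apply, smul_eq_mul]
      _ = _ := by
          rw [h1, map_sum, Finset.sum_apply]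
          refine Finset.sum_congr rfl fun k _ => ?_
          rw [map_smul, Pi.smul_apply, Matrix.cramer_apply, Matrix.cramer_apply, smul_eq_mul]
  have hother : ∀ k, k ≠ p ∧ k ≠ q → (X.updateCol k t).det * (X'.updateCol q (X.col k)).det = 0 := by
    rintro k ⟨hkp, hkq⟩
    rw [Matrix.det_zero_of_column_eq hkq (M := X'.updateCol q (X.col k)), mul_zero]
    intro i
    simp [hX', hkp, hkq]
  have hq : X'.updateCol q (X.col q) = X' := by
    ext i j
    by_cases hj : j = q
    · subst hj; simp [hX', hpq.symm]
    · simp [hj]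
  have hp : (X'.updateCol q (X.col p)).det = -(X.updateCol q z).det := by
    have h2 : X'.updateCol q (X.col p) = (X.updateCol q z).submatrix id (Equiv.swap p q) := by
      ext i j
      by_cases hj : j = q
      · subst hj; simp [hpq]
      · by_cases hj' : j = p
        · subst hj'; simp [hX', hpq]
        · simp [hX', hj, hj', Equiv.swap_apply_of_ne_of_ne hj' hj]
    rw [h2, Matrix.det_permute', Equiv.Perm.sign_swap hpq]
    simp
  rw [hlin, Fintype.sum_eq_add p q hpq hother, hp, hq]
  ring

theorem det_of_comp_perm {M : ℕ} (V : ℕ → Fin M → ℂ) (σ : Equiv.Perm (Fin M))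
    (f : Fin M → ℕ) :
    (Matrix.of fun j k : Fin M => V (f (σ k)) j).det
      = ((σ.sign : ℤ) : ℂ) * (Matrix.of fun j k : Fin M => V (f k) j).det := by
  rw [← Matrix.det_permute']
  rfl

theorem of_updateCol {M : ℕ} (V : ℕ → Fin M → ℂ) (f : Fin M → ℕ) (p : Fin M) (l : ℕ) :
    (Matrix.of fun j k : Fin M => V (f k) j).updateCol p (V l)
      = Matrix.of fun j k : Fin M => V (Function.update f p l k) j := by
  ext j k
  by_cases h : k = p
  · subst h; simp
  · simp [h]

/-- The Hirota-type bilinear relation between shifted Casorati determinants. -/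
theorem casorati_plucker (N a m : ℕ) (ha : 1 ≤ a) (haN : a ≤ N) (hm : 1 ≤ m)
    (w : ℕ → ℂ → ℂ) (v : ℂ) :
    casorati N w (fun k => if k < a then k else k + m) v
        * casorati N w (fun k => if k < a then k else k + m) (v + 2)
      = casorati N w (fun k => if k < a then k else k + (m - 1)) (v + 2)
          * casorati N w (fun k => if k < a then k else k + (m + 1)) v
        + casorati N w (fun k => if k < a - 1 then k else k + m) (v + 2)
          * casorati N w (fun k => if k < a + 1 then k else k + m) v := by
  obtain ⟨V, hV⟩ : ∃ V : ℕ → Fin (N + 1) → ℂ, V = fun (p : ℕ) (j : Fin (N + 1)) => w (j.1 + 1) (v + 2 * (p : ℂ)) :=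
    ⟨_, rfl⟩
  obtain ⟨W, hW⟩ : ∃ W : (Fin (N + 1) → ℕ) → ℂ,
    W = fun f => (Matrix.of fun j k : Fin (N + 1) => V (f k) j).det := ⟨_, rfl⟩
  have hc0 : ∀ idx : ℕ → ℕ, casorati N w idx v = W (fun k => idx k) := by
    intro idx; rw [hW, hV]; rfl
  have hc2 : ∀ idx : ℕ → ℕ, casorati N w idx (v + 2) = W (fun k => idx k + 1) := by
    intro idx; rw [hW, hV]; unfold casorati
    congr 1; ext j k; simp only [Matrix.of_apply]; congr 1; push_cast; ring
  have hperm : ∀ (σ : Equiv.Perm (Fin (N + 1))) (f g : Fin (N + 1) → ℕ), (∀ k, g k = f (σ k)) →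
      W g = ((σ.sign : ℤ) : ℂ) * W f := by
    intro σ f g h
    rw [funext h, hW]
    exact det_of_comp_perm V σ f
  obtain ⟨q, hq⟩ : ∃ q : Fin (N + 1), q.1 = a := ⟨⟨a, by omega⟩, rfl⟩
  have hpq : (0 : Fin (N + 1)) ≠ q := by
    intro h; rw [← h] at hq; simp at hq; omega
  obtain ⟨f, hf⟩ : ∃ f : Fin (N + 1) → ℕ, f = fun k => if k.1 < a then k.1 else k.1 + m := ⟨_, rfl⟩
  have key := Matrix.det_mul_det_updateCol_updateCol
    (Matrix.of fun j k : Fin (N + 1) => V (f k) j) hpq (V (N + m + 1)) (V a)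
  simp only [of_updateCol] at key
  have hkey : W f * W (Function.update (Function.update f 0 (N + m + 1)) q a)
      = W (Function.update f 0 (N + m + 1)) * W (Function.update f q a)
       - W (Function.update f q (N + m + 1)) * W (Function.update f 0 a) := by
    rw [hW]; exact key
  have hqpos : q ≠ 0 := hpq.symm
  have succ_val : ∀ k : Fin (N + 1), k.1 < N → (k + 1).1 = k.1 + 1 := fun k hk =>
    Fin.val_add_one_of_lt (by rw [Fin.lt_def]; simpa using hk)
  have rot : ∀ k : Fin (N + 1), (k.1 < N ∧ ((Fin.last N).cycleRange k).1 = k.1 + 1) ∨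
      (k.1 = N ∧ (Fin.last N).cycleRange k = 0) := by
    intro k
    by_cases h : k.1 < N
    · left; refine ⟨h, ?_⟩
      rw [Fin.cycleRange_of_lt (by rw [Fin.lt_def]; simpa using h), succ_val k h]
    · right
      have : k = Fin.last N := Fin.ext (by have := k.2; simp; omega)
      exact ⟨by simp [this], Fin.cycleRange_of_eq this⟩
  have sgn2 : (((Fin.last N).cycleRange.sign : ℤ) : ℂ) = (-1) ^ N := by
    rw [Fin.sign_cycleRange]; simp
  have upd : ∀ (g : Fin (N + 1) → ℕ) (p : Fin (N + 1)) (l : ℕ) (k : Fin (N + 1)),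
      Function.update g p l k = if k.1 = p.1 then l else g k := by
    intro g p l k
    simp [Function.update_apply, Fin.ext_iff]
  have hA : casorati N w (fun k => if k < a then k else k + m) v = W f := by rw [hc0, hf]
  have hB : casorati N w (fun k => if k < a then k else k + m) (v + 2)
      = (-1) ^ N * W (Function.update (Function.update f 0 (N + m + 1)) q a) := by
    rw [hc2, ← sgn2]
    apply hperm
    intro k
    simp only [upd, hf]
    rcases rot k with ⟨h, h'⟩ | ⟨h, h'⟩ <;> rw [h'] <;> simp <;> split_ifs <;> omega
  have hE : casorati N w (fun k => if k < a - 1 then k else k + m) (v + 2)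
      = (-1) ^ N * W (Function.update f 0 (N + m + 1)) := by
    rw [hc2, ← sgn2]
    apply hperm
    intro k
    simp only [upd, hf]
    rcases rot k with ⟨h, h'⟩ | ⟨h, h'⟩ <;> rw [h'] <;> simp <;> split_ifs <;> omega
  have hF : casorati N w (fun k => if k < a + 1 then k else k + m) v
      = W (Function.update f q a) := by
    rw [hc0]
    congr 1
    funext k
    simp only [upd, hf]
    split_ifs <;> omega
  have hC : casorati N w (fun k => if k < a then k else k + (m - 1)) (v + 2)
      = (-1) ^ (a - 1) * W (Function.update f 0 a) := by
    obtain ⟨i, hi⟩ : ∃ i : Fin (N + 1), i.1 = a - 1 := ⟨⟨a - 1, by omega⟩, rfl⟩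
    have hs : ((i.cycleRange.sign : ℤ) : ℂ) = (-1) ^ (a - 1) := by
      rw [Fin.sign_cycleRange, hi]; simp
    rw [hc2, ← hs]
    apply hperm
    intro k
    simp only [upd, hf]
    rcases lt_trichotomy k i with h | h | h
    · rw [Fin.cycleRange_of_lt h]
      rw [Fin.lt_def] at h
      rw [succ_val k (by omega)]
      simp; split_ifs <;> omega
    · rw [Fin.cycleRange_of_eq h, h]
      simp; split_ifs <;> omega
    · rw [Fin.cycleRange_of_gt h]
      rw [Fin.lt_def] at h
      simp; split_ifs <;> first | omega | simp_all
  have hD : casorati N w (fun k => if k < a then k else k + (m + 1)) v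
      = (-1) ^ (N - a) * W (Function.update f q (N + m + 1)) := by
    have hle : q ≤ Fin.last N := Fin.le_last q
    have hs : (((q.cycleIcc (Fin.last N)).sign : ℤ) : ℂ) = (-1) ^ (N - a) := by
      rw [Fin.sign_cycleIcc_of_le hle, hq]; simp
    rw [hc0, ← hs]
    apply hperm
    intro k
    simp only [upd, hf]
    by_cases h : k < q
    · rw [Fin.cycleIcc_of_lt h]
      rw [Fin.lt_def] at h
      split_ifs <;> omega
    · rw [not_lt] at h
      by_cases h2 : k < Fin.last N
      · rw [Fin.cycleIcc_of_ge_of_lt h h2]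
        rw [Fin.le_def] at h
        rw [Fin.lt_def, Fin.val_last] at h2
        rw [succ_val k h2]
        split_ifs <;> omega
      · have : k = Fin.last N := le_antisymm (Fin.le_last k) (not_lt.mp h2)
        rw [this, Fin.cycleIcc_of_last hle]
        simp [show ¬ N < a by omega]; omega
  have sgn : (-1 : ℂ) ^ (a - 1) * (-1) ^ (N - a) = - (-1) ^ N := by
    rw [← pow_add]
    have : N = (a - 1 + (N - a)) + 1 := by omega
    conv_rhs => rw [this, pow_succ]
    ring
  rw [hA, hB, hC, hD, hE, hF]
  linear_combination (-1) ^ N * hkey - W (Function.update f 0 a) * W (Function.update f q (N + m + 1)) * sgn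

open Finset

/-- `coefL x M a k` is the coefficient of `D ^ k` in the composition of the factors
`1 - x b D` over `b = M, …, M - a + 1`, the factor `b = M` outermost. -/
noncomputable def coefL (x : ℕ → ℂ → ℂ) (M : ℕ) : ℕ → ℤ → ℂ → ℂ
  | 0 => fun k _ => if k = 0 then 1 else 0
  | a + 1 => fun k u => coefL x M a k u - coefL x M a (k - 1) u * x (M - a) (u + 2 * k - 2)

theorem coefL_of_neg (x : ℕ → ℂ → ℂ) (M a : ℕ) {k : ℤ} (hk : k < 0) (u : ℂ) :
    coefL x M a k u = 0 := by
  induction a generalizing k with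
  | zero => simp [coefL, hk.ne]
  | succ a ih => simp [coefL, ih hk, ih (show k - 1 < 0 by omega)]

theorem coefL_of_gt (x : ℕ → ℂ → ℂ) (M a : ℕ) {k : ℤ} (hk : (a : ℤ) < k) (u : ℂ) :
    coefL x M a k u = 0 := by
  induction a generalizing k with
  | zero => simp at hk; simp [coefL, hk.ne']
  | succ a ih =>
    push_cast at hk
    simp [coefL, ih (show (a : ℤ) < k by omega), ih (show (a : ℤ) < k - 1 by omega)]

theorem coefL_zero (x : ℕ → ℂ → ℂ) (M a : ℕ) (u : ℂ) : coefL x M a 0 u = 1 := by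
  induction a with
  | zero => simp [coefL]
  | succ a ih => simp [coefL, ih, coefL_of_neg]

theorem coefL_top (x : ℕ → ℂ → ℂ) (M a : ℕ) (u : ℂ) :
    coefL x M a a u = (-1) ^ a * ∏ i ∈ range a, x (M - i) (u + 2 * i) := by
  induction a with
  | zero => simp [coefL]
  | succ a ih =>
    rw [prod_range_succ, pow_succ]
    simp only [coefL]
    rw [coefL_of_gt x M a (by push_cast; omega)]
    push_cast
    rw [add_sub_cancel_right, ih]
    rw [show u + 2 * ((a : ℂ) + 1) - 2 = u + 2 * a by ring]
    ring

theorem Lop_eq_sum (x w : ℕ → ℂ → ℂ) (M b : ℕ) {a : ℕ} (ha : a ≤ M) (u : ℂ) :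
    Lop x M (w b) u = ∑ k ∈ range (a + 1), coefL x M a k u * Lop x (M - a) (w b) (u + 2 * k) := by
  induction a with
  | zero => simp [coefL]
  | succ a ih =>
    rw [ih (by omega)]
    obtain ⟨c, hc⟩ : ∃ c, M - a = c + 1 := ⟨M - a - 1, by omega⟩
    have hc' : M - (a + 1) = c := by omega
    simp only [coefL, hc, hc', sub_mul, sum_sub_distrib]
    rw [sum_range_succ _ (a + 1), coefL_of_gt x M a (k := ((a + 1 : ℕ) : ℤ)) (by push_cast; omega),
      zero_mul, add_zero]
    rw [sum_range_succ' (fun k : ℕ => coefL x M a ((k : ℤ) - 1) u * _ * _),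
      coefL_of_neg x M a (k := ((0 : ℕ) : ℤ) - 1) (by simp), zero_mul, zero_mul, add_zero,
      ← sum_sub_distrib]
    refine sum_congr rfl fun k _ => ?_
    simp only [Lop, oneSubXD]
    push_cast
    rw [add_sub_cancel_right, show u + 2 * ((k : ℂ) + 1) - 2 = u + 2 * k by ring,
      show u + 2 * ((k : ℂ) + 1) = u + 2 * k + 2 by ring]
    ring

theorem Lfac_eq_sum (x : ℕ → ℂ → ℂ) (w : ℂ → ℂ) (N : ℕ) (s : ℂ) {a : ℕ} (ha : a ≤ N + 1) (u : ℂ) :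
    Lfac (fun c v => x c (v + (N : ℂ) + 1 - 2 * c + s)) N a w u
      = ∑ k ∈ range (a + 1), coefL x (N + 1) a ((a : ℤ) - k) (u - (N + 1) + s + 2 * k)
          * w (u + 2 * k) := by
  induction a generalizing u with
  | zero => simp [coefL, Lfac]
  | succ a ih =>
    simp only [Lfac, DsubF, ih (by omega), coefL, sub_mul, sum_sub_distrib]
    congr 1
    · rw [sum_range_succ' _ (a + 1), coefL_of_gt x (N + 1) a (by push_cast; omega), zero_mul,
        add_zero]
      refine sum_congr rfl fun k _ => ?_
      push_cast
      rw [add_sub_add_right_eq_sub]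
      congr 2 <;> ring
    · rw [sum_range_succ _ (a + 1), coefL_of_neg x (N + 1) a (by push_cast; omega), zero_mul,
        zero_mul, add_zero, mul_sum]
      refine sum_congr rfl fun k _ => ?_
      push_cast [show a ≤ N + 1 by omega]
      rw [show (a : ℤ) + 1 - k - 1 = a - k by ring,
        show u + N + 1 - 2 * (N + 1 - a : ℂ) + s
          = u - (N + 1) + s + 2 * k + 2 * ((a : ℂ) + 1 - k) - 2 by ring]
      ring

theorem coeff_eq_zero_of_casorati_ne_zero (N : ℕ) (w : ℕ → ℂ → ℂ) (u : ℂ)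
    (hxi : casorati N w (fun k => k) u ≠ 0) (c : ℕ → ℂ)
    (h : ∀ b, 1 ≤ b → b ≤ N + 1 → ∑ k ∈ range (N + 1), c k * w b (u + 2 * k) = 0) :
    ∀ k, k ≤ N → c k = 0 := by
  intro k hk
  have h0 := Matrix.eq_zero_of_mulVec_eq_zero hxi (v := fun k : Fin (N + 1) => c k) (by
    funext j
    rw [Pi.zero_apply, ← h (j.1 + 1) (by omega) (by omega), Finset.sum_range]
    simp only [Matrix.mulVec, dotProduct, Matrix.of_apply]
    exact Finset.sum_congr rfl fun k _ => mul_comm _ _)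
  exact congrFun h0 ⟨k, by omega⟩

theorem casorati_add_two (N : ℕ) (hN : Odd N) (w : ℕ → ℂ → ℂ) (u : ℂ) (c : ℕ → ℂ)
    (hc0 : c 0 = 1) (hcN : c (N + 1) = 1)
    (h : ∀ b, 1 ≤ b → b ≤ N + 1 → ∑ k ∈ range (N + 2), c k * w b (u + 2 * k) = 0) :
    casorati N w (fun k => k) (u + 2) = casorati N w (fun k => k) u := by
  obtain ⟨X, hX⟩ : ∃ X : Matrix (Fin (N + 1)) (Fin (N + 1)) ℂ,
    X = Matrix.of fun j k : Fin (N + 1) => w (j.1 + 1) (u + 2 * (k.1 : ℂ)) := ⟨_, rfl⟩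
  have h1 : casorati N w (fun k => k) (u + 2)
      = ((X.updateCol 0 fun j => ∑ i : Fin (N + 1), (-c i) • X j i).submatrix id
          (finRotate (N + 1))).det := by
    unfold casorati
    congr 1
    ext j k
    rw [Matrix.submatrix_apply, Matrix.of_apply, id]
    by_cases hk : k = Fin.last N
    · subst hk
      have := h (j.1 + 1) (by omega) (by omega)
      rw [sum_range_succ, hcN, Finset.sum_range] at this
      simp only [finRotate_last, Matrix.updateCol_self, hX, Matrix.of_apply, smul_eq_mul,
        neg_mul, Finset.sum_neg_distrib, Fin.val_last]
      rw [show u + 2 + 2 * (N : ℂ) = u + 2 * ((N + 1 : ℕ) : ℂ) by push_cast; ring]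
      linear_combination this
    · have hk' : k.1 < N := Fin.val_lt_last hk
      have hne : finRotate (N + 1) k ≠ 0 := by
        rw [Ne, Fin.ext_iff, coe_finRotate_of_ne_last hk]; simp
      rw [Matrix.updateCol_ne hne, hX, Matrix.of_apply, coe_finRotate_of_ne_last hk]
      congr 1; push_cast; ring
  rw [h1, Matrix.det_permute', Matrix.det_updateCol_sum, sign_finRotate]
  simp [hN.neg_one_pow, hc0, casorati, hX]

/-- The order of the columns `0, …, M + m - 1` in which the block `a, …, a + m - 1` comes last. -/
def blockPos (M m a : ℕ) (p : Fin M ⊕ Fin m) : ℕ :=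
  Sum.elim (fun k => if k.1 < a then k.1 else k.1 + m) (fun i => a + i.1) p

noncomputable def blockEquiv (M m a : ℕ) (ha : a ≤ M) : Fin M ⊕ Fin m ≃ Fin (M + m) :=
  Equiv.ofBijective (fun p => ⟨blockPos M m a p, by
      rcases p with k | i <;> simp only [blockPos, Sum.elim_inl, Sum.elim_inr]
      · split_ifs <;> omega
      · omega⟩) <| by
    rw [Fintype.bijective_iff_injective_and_card]
    refine ⟨?_, by simp⟩
    rintro (k | i) (k' | i') h <;>
      simp only [blockPos, Sum.elim_inl, Sum.elim_inr, Fin.mk.injEq] at h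
    · congr 1; ext; split_ifs at h <;> omega
    · exfalso; split_ifs at h <;> omega
    · exfalso; split_ifs at h <;> omega
    · congr 1; ext; omega

theorem blockEquiv_inl (M m a : ℕ) (ha : a ≤ M) (k : Fin M) :
    (blockEquiv M m a ha (Sum.inl k)).1 = if k.1 < a then k.1 else k.1 + m := rfl

theorem blockEquiv_inr (M m a : ℕ) (ha : a ≤ M) (i : Fin m) :
    (blockEquiv M m a ha (Sum.inr i)).1 = a + i.1 := rfl

theorem blockEquiv_add_two (M m a : ℕ) (ha : a + 2 ≤ M) :
    ∃ σ : Equiv.Perm (Fin (M + m)),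
      blockEquiv M m (a + 2) ha = ((blockEquiv M m a (by omega)).trans σ).trans σ := by
  obtain ⟨i, hi⟩ : ∃ i : Fin (M + m), i.1 = a := ⟨⟨a, by omega⟩, rfl⟩
  obtain ⟨j, hj⟩ : ∃ j : Fin (M + m), j.1 = a + m + 1 := ⟨⟨a + m + 1, by omega⟩, rfl⟩
  have hij : i ≤ j := by rw [Fin.le_def]; omega
  have hne : NeZero (M + m) := ⟨by omega⟩
  have hσ : ∀ k, (i.cycleIcc j k).1
      = if k.1 < a then k.1 else if k.1 < a + m + 1 then k.1 + 1
        else if k.1 = a + m + 1 then a else k.1 := by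
    intro k
    rcases lt_or_ge k i with h | h
    · rw [Fin.cycleIcc_of_lt h]
      rw [Fin.lt_def] at h
      split_ifs <;> omega
    · rcases lt_trichotomy k j with h2 | h2 | h2
      · rw [Fin.cycleIcc_of_ge_of_lt h h2]
        rw [Fin.le_def] at h
        rw [Fin.lt_def] at h2
        rw [Fin.val_add_one_of_lt' (by omega)]
        split_ifs <;> omega
      · rw [h2, Fin.cycleIcc_of_last hij]
        split_ifs <;> omega
      · rw [Fin.cycleIcc_of_gt h2]
        rw [Fin.le_def] at h
        rw [Fin.lt_def] at h2
        split_ifs <;> omega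
  have hσσ : ∀ k, (i.cycleIcc j (i.cycleIcc j k)).1
      = if k.1 < a then k.1 else if k.1 < a + m then k.1 + 2
        else if k.1 = a + m then a else if k.1 = a + m + 1 then a + 1 else k.1 := by
    intro k
    have hk := hσ k
    rw [hσ (i.cycleIcc j k)]
    split_ifs at hk ⊢ <;> omega
  refine ⟨i.cycleIcc j, ?_⟩
  ext p
  simp only [Equiv.trans_apply, hσσ]
  rcases p with k | l
  · simp only [blockEquiv_inl]
    split_ifs <;> omega
  · have h₁ := blockEquiv_inr M m a (by omega) l
    have h₂ := blockEquiv_inr M m (a + 2) ha l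
    rw [if_neg (by omega), if_pos (by omega)]
    omega

noncomputable def blockSign (M m a : ℕ) (ha : a ≤ M) : ℤˣ :=
  Equiv.Perm.sign ((blockEquiv M m a ha).trans finSumFinEquiv.symm)

theorem blockSign_add_two (M m a : ℕ) (ha : a + 2 ≤ M) :
    blockSign M m (a + 2) ha = blockSign M m a (by omega) := by
  obtain ⟨σ, hσ⟩ := blockEquiv_add_two M m a ha
  unfold blockSign
  rw [hσ]
  set e := blockEquiv M m a (by omega)
  have : ((e.trans σ).trans σ).trans finSumFinEquiv.symm
      = (e.trans finSumFinEquiv.symm).trans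
          (((finSumFinEquiv.trans σ).trans finSumFinEquiv.symm).trans
            ((finSumFinEquiv.trans σ).trans finSumFinEquiv.symm)) := by
    ext p; simp
  rw [this, Equiv.Perm.sign_trans, Equiv.Perm.sign_trans, Int.units_mul_self, one_mul]

/-- Casorati determinants with a gap of length `m` as Toeplitz determinants in the coefficients
of the difference equation (Jacobi–Trudi formula). -/
theorem casorati_eq_toeplitz (N m a : ℕ) (ha : a ≤ N + 1) (w : ℕ → ℂ → ℂ) (c : ℤ → ℂ → ℂ)
    (hneg : ∀ k < 0, ∀ u, c k u = 0) (hgt : ∀ k : ℤ, (N : ℤ) + 1 < k → ∀ u, c k u = 0)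
    (htop : ∀ u, c (N + 1) u = 1)
    (hrec : ∀ b, 1 ≤ b → b ≤ N + 1 → ∀ u, ∑ k ∈ range (N + 2), c k u * w b (u + 2 * k) = 0)
    (v : ℂ) :
    casorati N w (fun k => if k < a then k else k + m) v
      = ((blockSign (N + 1) m a ha : ℤ) : ℂ) * casorati N w (fun k => k) v
        * (Matrix.of fun i j : Fin m => c ((a : ℤ) + i.1 - j.1) (v + 2 * (j.1 : ℂ))).det := by
  set e := blockEquiv (N + 1) m a ha with he
  obtain ⟨S, hS⟩ : ∃ S : Matrix (Fin (N + 1)) (Fin (N + 1 + m)) ℂ,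
    S = Matrix.of fun j p => w (j.1 + 1) (v + 2 * (p.1 : ℂ)) := ⟨_, rfl⟩
  obtain ⟨B, hB⟩ : ∃ B : Matrix (Fin (N + 1 + m)) (Fin m) ℂ,
    B = Matrix.of fun p i => c ((p.1 : ℤ) - i.1) (v + 2 * (i.1 : ℂ)) := ⟨_, rfl⟩
  obtain ⟨I, hI⟩ : ∃ I : Matrix (Fin (N + 1 + m)) (Fin (N + 1)) ℂ,
    I = Matrix.of fun p k => if p = Fin.castAdd m k then 1 else 0 := ⟨_, rfl⟩
  obtain ⟨J, hJ⟩ : ∃ J : Matrix (Fin m) (Fin (N + 1 + m)) ℂ,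
    J = Matrix.of fun i p => if p = e (Sum.inr i) then 1 else 0 := ⟨_, rfl⟩
  have hSB : S * B = 0 := by
    ext j i
    rw [Matrix.mul_apply, hS, hB]
    simp only [Matrix.of_apply, Matrix.zero_apply]
    rw [← hrec (j.1 + 1) (by omega) (by omega) (v + 2 * i.1),
      ← Finset.sum_range (fun p => w (j.1 + 1) (v + 2 * (p : ℂ)) * c ((p : ℤ) - i.1) (v + 2 * (i.1 : ℂ)))]
    symm
    refine Finset.sum_of_injOn (fun k => i.1 + k) (fun _ _ _ _ h => by simpa using h) ?_ ?_ ?_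
    · intro k hk; simp at hk ⊢; omega
    · intro p hp hp'
      rcases lt_or_ge p i.1 with h | h
      · rw [hneg _ (by omega), mul_zero]
      · rw [hgt, mul_zero]
        by_contra hcon
        exact hp' ⟨p - i.1, by simp; omega, by simp; omega⟩
    · intro k _
      push_cast
      rw [add_sub_cancel_left, mul_comm, mul_add, add_assoc]
  have hSI : (S * I).det = casorati N w (fun k => k) v := by
    unfold casorati
    congr 1
    ext j k
    simp [Matrix.mul_apply, hS, hI]
  have hJB : J * B = Matrix.of fun i j : Fin m => c ((a : ℤ) + i.1 - j.1) (v + 2 * (j.1 : ℂ)) := by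
    ext i j
    simp [Matrix.mul_apply, hJ, hB, he, blockEquiv_inr]
  have hΓK : Matrix.fromRows S J * Matrix.fromCols I B
      = Matrix.fromBlocks (S * I) 0 (J * I) (J * B) := by
    rw [Matrix.fromRows_mul_fromCols, hSB]
  have hΓ : ((Matrix.fromRows S J).submatrix id e).det
      = casorati N w (fun k => if k < a then k else k + m) v := by
    have : (Matrix.fromRows S J).submatrix id e
        = Matrix.fromBlocks (Matrix.of fun j k : Fin (N + 1) =>
            w (j.1 + 1) (v + 2 * (((if k.1 < a then k.1 else k.1 + m : ℕ)) : ℂ)))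
          (S.submatrix id fun i => e (Sum.inr i)) 0 1 := by
      ext (j | j) (k | k)
      · simp only [Matrix.submatrix_apply, id, Matrix.fromRows_apply_inl, hS, Matrix.of_apply,
          he, blockEquiv_inl, Matrix.fromBlocks_apply₁₁]
      · simp
      · simp [hJ]
      · simp [hJ, Matrix.one_apply, eq_comm]
    rw [this, Matrix.det_fromBlocks_zero₂₁, Matrix.det_one, mul_one]
    rfl
  have hK0 : ((Matrix.fromCols I B).submatrix finSumFinEquiv id).det = 1 := by
    have : (Matrix.fromCols I B).submatrix finSumFinEquiv id
        = Matrix.fromBlocks 1 (B.submatrix (Fin.castAdd m) id) 0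
            (B.submatrix (Fin.natAdd (N + 1)) id) := by
      ext (j | j) (k | k)
      · simp [hI, Matrix.one_apply]
      · simp
      · have : Fin.natAdd (N + 1) j ≠ Fin.castAdd m k := by
          intro h; simp [Fin.ext_iff] at h; omega
        simp [hI, this]
      · simp
    rw [this, Matrix.det_fromBlocks_zero₂₁, Matrix.det_one, one_mul,
      Matrix.det_of_isUpperTriangular]
    · refine Finset.prod_eq_one fun i _ => ?_
      simp only [hB, Matrix.submatrix_apply, Matrix.of_apply, id, Fin.val_natAdd]
      push_cast
      rw [add_sub_cancel_right, htop]
    · intro i j hij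
      have hij' : j.1 < i.1 := hij
      simp only [hB, Matrix.submatrix_apply, Matrix.of_apply, id, Fin.val_natAdd]
      exact hgt _ (by push_cast; omega) _
  have hK : ((Matrix.fromCols I B).submatrix e id).det
      = ((blockSign (N + 1) m a ha : ℤ) : ℂ) := by
    have : (Matrix.fromCols I B).submatrix e id
        = ((Matrix.fromCols I B).submatrix finSumFinEquiv id).submatrix
            (e.trans finSumFinEquiv.symm) id := by
      ext p q; simp
    rw [this, Matrix.det_permute, hK0, mul_one]
    rfl
  have key : ((Matrix.fromRows S J).submatrix id e).det
      * ((Matrix.fromCols I B).submatrix e id).det = (S * I).det * (J * B).det := by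
    rw [← Matrix.det_mul, Matrix.submatrix_mul_equiv, hΓK, Matrix.submatrix_id_id,
      Matrix.det_fromBlocks_zero₁₂]
  rw [hΓ, hK, hSI, hJB] at key
  have hsq : ((blockSign (N + 1) m a ha : ℤ) : ℂ) * ((blockSign (N + 1) m a ha : ℤ) : ℂ) = 1 := by
    rw [← Int.cast_mul, ← Units.val_mul, Int.units_mul_self, Units.val_one, Int.cast_one]
  rw [mul_assoc, ← key, mul_comm, mul_assoc, hsq, mul_one]

theorem prod_bethe_weights (n : ℕ) (hn : 2 ≤ n) (s : ℂ) (Y x : ℕ → ℂ → ℂ)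
    (hY0 : ∀ u, Y 0 u = 1) (hYne : ∀ a, a ≤ n → ∀ u, Y a u ≠ 0)
    (hxa : ∀ a, 1 ≤ a → a ≤ n - 1 → ∀ u : ℂ, x a u = Y a (u + a) / Y (a - 1) (u + a + 1))
    (hxn : ∀ u : ℂ, x n u = Y n (u + n) * Y n (u + n + s) / Y (n - 1) (u + n + 1))
    (hxnbar : ∀ u : ℂ, x (n + 1) u
      = Y (n - 1) (u + n + 1 + s) / (Y n (u + n + 2) * Y n (u + n + 2 + s)))
    (hxbar : ∀ a, 1 ≤ a → a ≤ n - 1 → ∀ u : ℂ,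
      x (2 * n - a + 1) u = Y (a - 1) (u + 2 * (n : ℂ) - a + 1 + s)
        / Y a (u + 2 * (n : ℂ) - a + 2 + s)) (u : ℂ) :
    ∏ i ∈ range (2 * n), x (2 * n - i) (u + 2 * i) = 1 := by
  have h1 : ∀ t, t ≤ n - 1 →
      ∏ i ∈ range t, x (2 * n - i) (u + 2 * i) = 1 / Y t (u + 2 * n + t + s) := by
    intro t ht
    induction t with
    | zero => simp [hY0]
    | succ t ih =>
      have := hxbar (t + 1) (by omega) ht (u + 2 * t)
      rw [show 2 * n - (t + 1) + 1 = 2 * n - t by omega, Nat.add_sub_cancel] at this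
      rw [prod_range_succ, ih (by omega), this]
      push_cast
      rw [show u + 2 * t + 2 * n - ((t : ℂ) + 1) + 1 + s = u + 2 * n + t + s by ring,
        show u + 2 * t + 2 * n - ((t : ℂ) + 1) + 2 + s = u + 2 * n + (t + 1) + s by ring]
      have := hYne t (by omega) (u + 2 * n + t + s)
      field_simp
  have h2 : ∀ t, t + 1 ≤ n → ∏ i ∈ range (t + 1), x (n - i) (u + 2 * n + 2 * i)
      = Y n (u + 3 * n) * Y n (u + 3 * n + s) / Y (n - (t + 1)) (u + 3 * n + t + 1) := by
    intro t ht
    induction t with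
    | zero =>
      rw [prod_range_one, Nat.sub_zero, hxn]
      push_cast
      rw [show u + 2 * n + 2 * 0 + (n : ℂ) = u + 3 * n by ring, add_zero]
    | succ t ih =>
      rw [prod_range_succ, ih (by omega), hxa (n - (t + 1)) (by omega) (by omega),
        show n - (t + 1) - 1 = n - (t + 1 + 1) by omega]
      push_cast [show t + 1 ≤ n by omega]
      rw [show u + 2 * n + 2 * ((t : ℂ) + 1) + (n - (t + 1)) = u + 3 * n + t + 1 by ring,
        show u + 3 * n + (t : ℂ) + 1 + 1 = u + 3 * n + (t + 1) + 1 by ring]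
      have := hYne (n - (t + 1)) (by omega) (u + 3 * n + t + 1)
      field_simp
  obtain ⟨t, rfl⟩ : ∃ t, n = t + 1 := ⟨n - 1, by omega⟩
  rw [two_mul, prod_range_add, ← two_mul, prod_range_succ, h1 t (by omega)]
  have h3 : ∏ i ∈ range (t + 1), x (2 * (t + 1) - (t + 1 + i)) (u + 2 * ((t + 1 + i : ℕ) : ℂ))
      = ∏ i ∈ range (t + 1), x (t + 1 - i) (u + 2 * ((t + 1 : ℕ) : ℂ) + 2 * i) := by
    refine prod_congr rfl fun i _ => ?_
    rw [show 2 * (t + 1) - (t + 1 + i) = t + 1 - i by omega]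
    congr 1; push_cast; ring
  rw [h3, h2 t le_rfl, Nat.sub_self, hY0, show 2 * (t + 1) - t = t + 1 + 1 by omega, hxnbar,
    Nat.add_sub_cancel]
  push_cast
  rw [show u + 2 * t + ((t : ℂ) + 1) + 1 + s = u + 2 * (t + 1) + t + s by ring,
    show u + 2 * t + ((t : ℂ) + 1) + 2 = u + 3 * (t + 1) by ring]
  have e1 := hYne t (by omega) (u + 2 * (t + 1) + t + s)
  have e2 := hYne (t + 1) (by omega) (u + 3 * (t + 1))
  have e3 := hYne (t + 1) (by omega) (u + 3 * (t + 1) + s)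
  generalize Y t (u + 2 * (t + 1) + t + s) = y₁ at *
  generalize Y (t + 1) (u + 3 * (t + 1)) = y₂ at *
  generalize Y (t + 1) (u + 3 * (t + 1) + s) = y₃ at *
  field_simp

theorem Tsystem_A2_odd
    (n : ℕ) (hn : 2 ≤ n) (N : ℕ) (hN : N = 2 * n - 1)
    (hbar : ℂ) (hbar_ne : hbar ≠ 0) (s : ℂ)
    (hs : s = (Real.pi : ℂ) * Complex.I / (2 * hbar))
    (Q : ℕ → ℂ → ℂ) (hQ0 : ∀ u, Q 0 u = 1)
    (hQne : ∀ a, 1 ≤ a → a ≤ n → ∀ u, Q a u ≠ 0)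
    (hconst : ℕ → ℂ)
    (hQper : ∀ a, 1 ≤ a → a ≤ n → hconst a ≠ 0 ∧
      ∀ u, Q a (u + (Real.pi : ℂ) * Complex.I / hbar) = hconst a * Q a u)
    (Y : ℕ → ℂ → ℂ) (hY : ∀ a u, Y a u = Q a (u - 1) / Q a (u + 1))
    (x : ℕ → ℂ → ℂ)
    (hxa : ∀ a, 1 ≤ a → a ≤ n - 1 → ∀ u : ℂ,
      x a u = Y a (u + a) / Y (a - 1) (u + a + 1))
    (hxn : ∀ u : ℂ, x n u = Y n (u + n) * Y n (u + n + s) / Y (n - 1) (u + n + 1))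
    (hxnbar : ∀ u : ℂ, x (n + 1) u
      = Y (n - 1) (u + n + 1 + s) / (Y n (u + n + 2) * Y n (u + n + 2 + s)))
    (hxbar : ∀ a, 1 ≤ a → a ≤ n - 1 → ∀ u : ℂ,
      x (2 * n - a + 1) u = Y (a - 1) (u + 2 * (n : ℂ) - a + 1 + s)
        / Y a (u + 2 * (n : ℂ) - a + 2 + s))
    (w : ℕ → ℂ → ℂ)
    (hw : ∀ b, 1 ≤ b → b ≤ N + 1 → ∀ u : ℂ, Lop x (N + 1) (w b) u = 0)
    (hLfac : ∀ a b : ℕ, 1 ≤ b → b ≤ a → a ≤ N + 1 → ∀ u : ℂ,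
      Lfac (fun c v => x c (v + (N : ℂ) + 1 - 2 * c + s)) N a (w b) u = 0)
    (hxi : ∀ u : ℂ, casorati N w (fun k => k) u ≠ 0)
    (Tf : ℕ → ℕ → ℂ → ℂ)
    (hTf : ∀ a m : ℕ, ∀ u : ℂ, Tf a m u
      = casorati N w (fun k => if k < a then k else k + m) (u - a - m + 1)
        / casorati N w (fun k => k) (u - a - m + 1))
    :
    (∀ m : ℕ, 1 ≤ m → ∀ a : ℕ, 1 ≤ a → a ≤ n - 1 → ∀ u : ℂ,
      Tf a m (u - 1) * Tf a m (u + 1)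
        = Tf a (m - 1) u * Tf a (m + 1) u + Tf (a - 1) m u * Tf (a + 1) m u) ∧
    (∀ m : ℕ, 1 ≤ m → ∀ u : ℂ,
      Tf n m (u - 1) * Tf n m (u + 1)
        = Tf n (m - 1) u * Tf n (m + 1) u + Tf (n - 1) m u * Tf (n - 1) m (u + s)) ∧
    (∀ m : ℕ, ∀ u : ℂ, Tf 0 m u = 1) := by
  have hYne : ∀ a, a ≤ n → ∀ u, Y a u ≠ 0 := by
    intro a ha u
    rcases Nat.eq_zero_or_pos a with rfl | h
    · simp [hY, hQ0]
    · rw [hY]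
      exact div_ne_zero (hQne a h ha _) (hQne a h ha _)
  have hY0 : ∀ u, Y 0 u = 1 := fun u => by simp [hY, hQ0]
  have hM : N + 1 = 2 * n := by omega
  obtain ⟨c, hc⟩ : ∃ c, c = coefL x (N + 1) (N + 1) := ⟨_, rfl⟩
  have htop : ∀ u, c (N + 1) u = 1 := by
    intro u
    have := coefL_top x (N + 1) (N + 1) u
    push_cast at this
    rw [hc, this, hM, prod_bethe_weights n hn s Y x hY0 hYne hxa hxn hxnbar hxbar]
    simp
  have hzero : ∀ u, c 0 u = 1 := fun u => by rw [hc]; exact coefL_zero _ _ _ _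
  have hneg : ∀ k < 0, ∀ u, c k u = 0 := fun k hk u => by rw [hc]; exact coefL_of_neg _ _ _ hk _
  have hgt : ∀ k : ℤ, (N : ℤ) + 1 < k → ∀ u, c k u = 0 := fun k hk u => by
    rw [hc]; exact coefL_of_gt _ _ _ (by push_cast; omega) _
  have hrec : ∀ b, 1 ≤ b → b ≤ N + 1 → ∀ u,
      ∑ k ∈ range (N + 2), c k u * w b (u + 2 * k) = 0 := by
    intro b hb hb' u
    rw [← hw b hb hb' u, Lop_eq_sum x w (N + 1) b le_rfl u, hc]
    simp [Lop]
  have hrec' : ∀ b, 1 ≤ b → b ≤ N + 1 → ∀ u,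
      ∑ k ∈ range (N + 2), c ((N : ℤ) + 1 - k) (u - (N + 1) + s + 2 * k) * w b (u + 2 * k) = 0 := by
    intro b hb hb' u
    rw [← hLfac (N + 1) b hb hb' le_rfl u, Lfac_eq_sum x (w b) N s le_rfl u, hc]
    simp
  have hsym : ∀ (k : ℤ) (u : ℂ), c k u = c ((N : ℤ) + 1 - k) (u - (N + 1) + s + 2 * k) := by
    intro k u
    rcases lt_or_ge k 0 with h | h
    · rw [hneg k h, hgt _ (by omega)]
    rcases lt_trichotomy k ((N : ℤ) + 1) with h2 | h2 | h2
    · obtain ⟨l, rfl⟩ := Int.eq_ofNat_of_zero_le h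
      have := coeff_eq_zero_of_casorati_ne_zero N w u (hxi u)
        (fun k => c k u - c ((N : ℤ) + 1 - k) (u - (N + 1) + s + 2 * k)) (by
          intro b hb hb'
          have e1 := hrec b hb hb' u
          have e2 := hrec' b hb hb' u
          rw [sum_range_succ] at e1 e2
          push_cast at e1 e2
          rw [htop] at e1
          rw [sub_self, hzero] at e2
          simp only [sub_mul, sum_sub_distrib]
          linear_combination e1 - e2) l (by omega)
      simpa [sub_eq_zero] using this
    · rw [h2, htop, sub_self, hzero]
    · rw [hgt k h2, hneg _ (by omega)]
  have hodd : Odd N := ⟨n - 1, by omega⟩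
  have hper : ∀ u, casorati N w (fun k => k) (u + 2) = casorati N w (fun k => k) u := by
    intro u
    exact casorati_add_two N hodd w u (fun k => c k u) (hzero u) (by push_cast; exact htop u)
      fun b hb hb' => hrec b hb hb' u
  have hT : ∀ m : ℕ, 1 ≤ m → ∀ a : ℕ, 1 ≤ a → a ≤ N → ∀ u : ℂ,
      Tf a m (u - 1) * Tf a m (u + 1)
        = Tf a (m - 1) u * Tf a (m + 1) u + Tf (a - 1) m u * Tf (a + 1) m u := by
    intro m hm a ha haN u
    have key := casorati_plucker N a m ha haN hm w (u - a - m)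
    simp only [hTf]
    push_cast [ha, hm]
    rw [show u - 1 - a - m + 1 = u - a - m by ring,
      show u + 1 - a - m + 1 = u - a - m + 2 by ring,
      show u - a - ((m : ℂ) - 1) + 1 = u - a - m + 2 by ring,
      show u - a - ((m : ℂ) + 1) + 1 = u - a - m by ring,
      show u - ((a : ℂ) - 1) - m + 1 = u - a - m + 2 by ring,
      show u - ((a : ℂ) + 1) - m + 1 = u - a - m by ring, hper]
    simp only [div_mul_div_comm]
    rw [← add_div, key]
  have hratio : ∀ (a m : ℕ) (ha : a ≤ N + 1) (u : ℂ), Tf a m u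
      = ((blockSign (N + 1) m a ha : ℤ) : ℂ) * (Matrix.of fun i j : Fin m =>
          c ((a : ℤ) + i.1 - j.1) (u - a - m + 1 + 2 * (j.1 : ℂ))).det := by
    intro a m ha u
    rw [hTf, casorati_eq_toeplitz N m a ha w c hneg hgt htop hrec, mul_right_comm,
      mul_div_cancel_right₀ _ (hxi _)]
  have hdual : ∀ (m : ℕ) (u : ℂ), Tf (n + 1) m u = Tf (n - 1) m (u + s) := by
    intro m u
    rw [hratio (n + 1) m (by omega), hratio (n - 1) m (by omega)]
    have hsign : blockSign (N + 1) m (n + 1) (by omega)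
        = blockSign (N + 1) m (n - 1) (by omega) := by
      have := blockSign_add_two (N + 1) m (n - 1) (by omega)
      simp only [show n - 1 + 2 = n + 1 by omega] at this
      exact this
    rw [hsign, ← Matrix.det_transpose]
    congr 2
    ext i j
    simp only [Matrix.transpose_apply, Matrix.of_apply]
    rw [hsym]
    have hNC : (N : ℂ) + 1 = 2 * n := by exact_mod_cast hM
    rw [hNC]
    congr 1
    · push_cast [show 1 ≤ n by omega]
      omega
    · push_cast [show 1 ≤ n by omega]
      ring
  refine ⟨fun m hm a ha ha' u => hT m hm a ha (by omega) u, fun m hm u => ?_, fun m u => ?_⟩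
  · rw [hT m hm n (by omega) (by omega) u, hdual]
  · have hperm : ∀ v : ℂ, casorati N w (fun k => k) (v + 2 * m) = casorati N w (fun k => k) v := by
      intro v
      induction m with
      | zero => simp
      | succ m ih => rw [← ih, ← hper (v + 2 * m)]; congr 1; push_cast; ring
    rw [hTf, div_eq_one_iff_eq (hxi _), ← hperm]
    unfold casorati
    congr 1
    ext j k
    simp only [Matrix.of_apply, Nat.not_lt_zero, if_false]
    congr 1; push_cast; ring
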